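/- arXiv:1605.06631 — 2 statements merged into one kernel-verified Lean document; each statement's English description precedes it below -/
import Mathlib

section
/- For |q|<1, the product of theta functions satisfies φ(q)·φ(q³) = 1 + 2·∑_{j≥1} χ₃(j)·( q^j/(1−q^j) + 2q^{4j}/(1−q^{4j}) ), where χ₃(j) is the Legendre symbol (j/3). -/
noncomputable section

/-- The norm form `a² + ab + b²` of the Eisenstein integers. -/
def eisNorm (v : ℤ × ℤ) : ℤ := v.1 ^ 2 + v.1 * v.2 + v.2 ^ 2

/-- Multiplication of `a + bω` and `x + yω`, where `ω² = ω - 1`. -/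
def eisMul (u v : ℤ × ℤ) : ℤ × ℤ :=
  (u.1 * v.1 - u.2 * v.2, u.1 * v.2 + u.2 * v.1 + u.2 * v.2)

/-- Conjugation on Eisenstein integers. -/
def eisConj (u : ℤ × ℤ) : ℤ × ℤ := (u.1 + u.2, -u.2)

/-- The representations of `n` by the Eisenstein norm form. -/
def eisReps (n : ℤ) : Set (ℤ × ℤ) := {v | eisNorm v = n}

/-- The divisor sum `∑_{d ∣ n} χ₃(d)`. -/
def divisorSumChi (n : ℕ) : ℤ := ∑ d ∈ n.divisors, legendreSym 3 d

theorem eisNorm_mul (u v : ℤ × ℤ) : eisNorm (eisMul u v) = eisNorm u * eisNorm v := by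
  simp only [eisNorm, eisMul]; ring

theorem eisNorm_conj (u : ℤ × ℤ) : eisNorm (eisConj u) = eisNorm u := by
  simp only [eisNorm, eisConj]; ring

theorem eisNorm_smul (p : ℤ) (v : ℤ × ℤ) : eisNorm (p • v) = p ^ 2 * eisNorm v := by
  simp only [eisNorm, Prod.smul_fst, Prod.smul_snd, smul_eq_mul]; ring

theorem eisMul_conj_mul (u v : ℤ × ℤ) : eisMul (eisConj u) (eisMul u v) = eisNorm u • v := by
  ext <;> simp only [eisNorm, eisMul, eisConj, Prod.smul_fst, Prod.smul_snd, smul_eq_mul] <;> ring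

theorem eisMul_mul_conj (u v : ℤ × ℤ) : eisMul u (eisMul (eisConj u) v) = eisNorm u • v := by
  ext <;> simp only [eisNorm, eisMul, eisConj, Prod.smul_fst, Prod.smul_snd, smul_eq_mul] <;> ring

theorem eisMul_smul (p : ℤ) (u v : ℤ × ℤ) : eisMul u (p • v) = p • eisMul u v := by
  ext <;> simp only [eisMul, Prod.smul_fst, Prod.smul_snd, smul_eq_mul] <;> ring

theorem smul_int_prod_injective {p : ℤ} (hp : p ≠ 0) :
    Function.Injective (fun v : ℤ × ℤ => p • v) :=
  smul_right_injective _ hp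

theorem eisMul_injective {u : ℤ × ℤ} (hu : eisNorm u ≠ 0) : Function.Injective (eisMul u) := by
  intro v w h
  apply smul_int_prod_injective hu
  simp only [← eisMul_conj_mul, h]

theorem four_mul_eisNorm (v : ℤ × ℤ) :
    4 * eisNorm v = (2 * v.1 + v.2) ^ 2 + 3 * v.2 ^ 2 := by
  simp only [eisNorm]; ring

theorem eisNorm_nonneg (v : ℤ × ℤ) : 0 ≤ eisNorm v := by
  have := four_mul_eisNorm v
  nlinarith [sq_nonneg (2 * v.1 + v.2), sq_nonneg v.2]

theorem abs_add_abs_le_eisNorm (v : ℤ × ℤ) : |v.1| + |v.2| ≤ 2 * eisNorm v := by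
  have h (x : ℤ) : |x| ≤ x ^ 2 := by
    rw [← sq_abs]
    rcases (abs_nonneg x).eq_or_lt with h | h <;> nlinarith
  have h1 := h v.1
  have h2 := h v.2
  simp only [eisNorm]
  nlinarith [sq_nonneg (v.1 + v.2)]

theorem eisReps_finite (n : ℤ) : (eisReps n).Finite := by
  refine (Set.finite_Icc ((-(2 * n), -(2 * n)) : ℤ × ℤ) (2 * n, 2 * n)).subset ?_
  rintro v rfl
  have := abs_add_abs_le_eisNorm v
  have h1 := abs_le.1 (show |v.1| ≤ 2 * eisNorm v by linarith [abs_nonneg v.2])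
  have h2 := abs_le.1 (show |v.2| ≤ 2 * eisNorm v by linarith [abs_nonneg v.1])
  exact ⟨⟨h1.1, h2.1⟩, h1.2, h2.2⟩

theorem ncard_eisReps_one : (eisReps 1).ncard = 6 := by
  have : eisReps 1 =
      (({(1, 0), (-1, 0), (0, 1), (0, -1), (1, -1), (-1, 1)} : Finset (ℤ × ℤ)) : Set (ℤ × ℤ)) := by
    ext v
    constructor
    · intro hv
      have h := abs_add_abs_le_eisNorm v
      rw [show eisNorm v = 1 from hv] at h
      have h1 := abs_le.1 (show |v.1| ≤ 2 by linarith [abs_nonneg v.2])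
      have h2 := abs_le.1 (show |v.2| ≤ 2 by linarith [abs_nonneg v.1])
      obtain ⟨x, y⟩ := v
      simp only [eisReps, eisNorm, Set.mem_ofPred_eq] at hv h1 h2
      obtain ⟨h1, h1'⟩ := h1
      obtain ⟨h2, h2'⟩ := h2
      interval_cases x <;> interval_cases y <;> simp_all
    · simp only [Finset.coe_insert, Finset.coe_singleton, Set.mem_insert_iff,
        Set.mem_singleton_iff, eisReps, Set.mem_ofPred_eq]
      rintro (rfl | rfl | rfl | rfl | rfl | rfl) <;> norm_num [eisNorm]
  rw [this, Set.ncard_coe_finset]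
  rfl

theorem exists_smul_of_dvd {p : ℤ} {v : ℤ × ℤ} (h1 : p ∣ v.1) (h2 : p ∣ v.2) :
    ∃ w, v = p • w := by
  obtain ⟨x, hx⟩ := h1
  obtain ⟨y, hy⟩ := h2
  exact ⟨(x, y), Prod.ext hx hy⟩

theorem eisReps_sq_mul_of_forall_dvd {p : ℤ} (hp : p ≠ 0) (n : ℤ)
    (h : ∀ v, p ∣ eisNorm v → p ∣ v.1 ∧ p ∣ v.2) :
    (eisReps (p * (p * n))).ncard = (eisReps n).ncard := by
  rw [← Set.ncard_image_of_injective (eisReps n) (smul_int_prod_injective hp)]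
  congr 1
  ext v
  constructor
  · intro hv
    obtain ⟨h1, h2⟩ := h v ⟨_, hv⟩
    obtain ⟨w, rfl⟩ := exists_smul_of_dvd h1 h2
    refine ⟨w, ?_, rfl⟩
    simp only [eisReps, Set.mem_ofPred_eq, eisNorm_smul] at hv ⊢
    have : p ^ 2 ≠ 0 := pow_ne_zero _ hp
    exact mul_left_cancel₀ this (by rw [hv]; ring)
  · rintro ⟨w, hw, rfl⟩
    simp only [eisReps, Set.mem_ofPred_eq, eisNorm_smul] at hw ⊢
    rw [hw]; ring

theorem eisReps_mul_of_forall_dvd {p : ℤ} (hp : p ≠ 0) {n : ℤ} (hn : ¬ p ∣ n)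
    (h : ∀ v, p ∣ eisNorm v → p ∣ v.1 ∧ p ∣ v.2) :
    (eisReps (p * n)).ncard = 0 := by
  rw [Set.ncard_eq_zero (eisReps_finite _), Set.eq_empty_iff_forall_notMem]
  intro v hv
  obtain ⟨h1, h2⟩ := h v ⟨_, hv⟩
  obtain ⟨w, rfl⟩ := exists_smul_of_dvd h1 h2
  simp only [eisReps, Set.mem_ofPred_eq, eisNorm_smul] at hv
  exact hn ⟨eisNorm w, mul_left_cancel₀ hp (by rw [← hv]; ring)⟩

theorem ncard_eisReps_three_mul (n : ℤ) : (eisReps (3 * n)).ncard = (eisReps n).ncard := by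
  have h3 : eisNorm (1, 1) = 3 := by norm_num [eisNorm]
  rw [← Set.ncard_image_of_injective (eisReps n) (eisMul_injective (u := (1, 1)) (by simp [h3]))]
  congr 1
  ext v
  constructor
  · intro hv
    simp only [eisReps, Set.mem_ofPred_eq] at hv
    have hd : (3 : ℤ) ∣ v.1 - v.2 := by
      refine Int.prime_three.dvd_of_dvd_pow (n := 2) ⟨n - v.1 * v.2, ?_⟩
      simp only [eisNorm] at hv
      linear_combination hv
    obtain ⟨k, hk⟩ := hd
    refine ⟨(v.2 + 2 * k, -k), ?_, ?_⟩
    · simp only [eisReps, Set.mem_ofPred_eq, eisNorm] at hv ⊢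
      have : v.1 = v.2 + 3 * k := by linarith
      rw [this] at hv
      nlinarith
    · ext <;> simp [eisMul] <;> linarith
  · rintro ⟨w, hw, rfl⟩
    simp only [eisReps, Set.mem_ofPred_eq, eisNorm_mul] at hw ⊢
    rw [hw, h3]

theorem exists_eisMul_of_dvd_snd {p : ℤ} (hp : Prime p) {u : ℤ × ℤ} (hu : eisNorm u = p)
    {v : ℤ × ℤ} (hv : p ∣ eisNorm v)
    (h : p ∣ (eisMul (eisConj u) v).2) : ∃ w, v = eisMul u w := by
  have h1 : p ∣ (eisMul (eisConj u) v).1 := by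
    have hN : p ∣ eisNorm (eisMul (eisConj u) v) := by
      rw [eisNorm_mul]; exact hv.mul_left _
    refine hp.dvd_of_dvd_pow (n := 2) ?_
    have : (eisMul (eisConj u) v).1 ^ 2 = eisNorm (eisMul (eisConj u) v) -
        (eisMul (eisConj u) v).2 * ((eisMul (eisConj u) v).1 + (eisMul (eisConj u) v).2) := by
      simp only [eisNorm]; ring
    rw [this]
    exact dvd_sub hN (h.mul_right _)
  obtain ⟨w, hw⟩ := exists_smul_of_dvd h1 h
  refine ⟨w, smul_int_prod_injective hp.ne_zero ?_⟩
  simp only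
  rw [← eisMul_smul, ← hw, eisMul_mul_conj, hu]

theorem eisReps_mul_eq_union {p : ℤ} (hp : Prime p) {u : ℤ × ℤ} (hu : eisNorm u = p)
    (n : ℤ) :
    eisReps (p * n) = eisMul u '' eisReps n ∪ eisMul (eisConj u) '' eisReps n := by
  have key (u : ℤ × ℤ) (hu : eisNorm u = p) (v : ℤ × ℤ) (hv : eisNorm v = p * n)
      (h : p ∣ (eisMul (eisConj u) v).2) : v ∈ eisMul u '' eisReps n := by
    obtain ⟨w, rfl⟩ := exists_eisMul_of_dvd_snd hp hu ⟨n, hv⟩ h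
    rw [eisNorm_mul, hu] at hv
    exact ⟨w, mul_left_cancel₀ hp.ne_zero hv, rfl⟩
  have hcc : eisConj (eisConj u) = u := by ext <;> simp [eisConj]
  ext v
  constructor
  · intro hv
    simp only [eisReps, Set.mem_ofPred_eq] at hv
    have : p ∣ (eisMul (eisConj u) v).2 * (eisMul u v).2 := by
      have : (eisMul (eisConj u) v).2 * (eisMul u v).2 =
          v.2 ^ 2 * eisNorm u - u.2 ^ 2 * eisNorm v := by
        simp only [eisNorm, eisMul, eisConj]; ring
      rw [this, hu, hv]
      exact ⟨v.2 ^ 2 - u.2 ^ 2 * n, by ring⟩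
    rcases hp.dvd_or_dvd this with h | h
    · exact Or.inl (key u hu v hv h)
    · exact Or.inr (key (eisConj u) (by rw [eisNorm_conj, hu]) v hv (by rwa [hcc]))
  · rintro (⟨w, hw, rfl⟩ | ⟨w, hw, rfl⟩) <;>
      simp only [eisReps, Set.mem_ofPred_eq, eisNorm_mul, eisNorm_conj] at hw ⊢ <;> rw [hw, hu]

theorem eisMul_image_inter {p : ℤ} (hp : Prime p) {u : ℤ × ℤ} (hu : eisNorm u = p)
    (h2 : ¬ p ∣ 2) (h3 : ¬ p ∣ 3) (n : ℤ) :
    eisMul u '' eisReps n ∩ eisMul (eisConj u) '' eisReps n =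
      (fun v : ℤ × ℤ => p • v) '' {v | p * eisNorm v = n} := by
  have htr : ¬ p ∣ 2 * u.1 + u.2 := by
    intro h
    have h4 := four_mul_eisNorm u
    rw [hu] at h4
    have hb : p ∣ u.2 := by
      have : p ∣ 3 * u.2 ^ 2 := by
        rw [show 3 * u.2 ^ 2 = 4 * p - (2 * u.1 + u.2) ^ 2 by linarith]
        exact dvd_sub (dvd_mul_left _ _) (dvd_pow h two_ne_zero)
      exact hp.dvd_of_dvd_pow ((hp.dvd_or_dvd this).resolve_left h3)
    obtain ⟨x, hx⟩ := h
    obtain ⟨y, hy⟩ := hb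
    rw [hx, hy] at h4
    have : p ∣ 2 ^ 2 := ⟨x ^ 2 + 3 * y ^ 2, mul_left_cancel₀ hp.ne_zero (by linarith)⟩
    exact h2 (hp.dvd_of_dvd_pow this)
  ext v
  constructor
  · rintro ⟨⟨x, hx, rfl⟩, y, hy, hxy⟩
    have e1 := eisMul_conj_mul u x
    have e2 := eisMul_mul_conj u y
    rw [hxy] at e2
    rw [hu] at e1 e2
    set v := eisMul u x with hv
    have t : (2 * u.1 + u.2) • v = p • (x + y) := by
      rw [smul_add, ← e1, ← e2]
      ext <;> simp only [eisMul, eisConj, Prod.smul_fst, Prod.smul_snd, smul_eq_mul,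
        Prod.fst_add, Prod.snd_add] <;> ring
    have h1 : p ∣ v.1 := (hp.dvd_or_dvd (show p ∣ (2 * u.1 + u.2) * v.1 from
      ⟨(x + y).1, congrArg Prod.fst t⟩)).resolve_left htr
    have h2 : p ∣ v.2 := (hp.dvd_or_dvd (show p ∣ (2 * u.1 + u.2) * v.2 from
      ⟨(x + y).2, congrArg Prod.snd t⟩)).resolve_left htr
    obtain ⟨w, hw⟩ := exists_smul_of_dvd h1 h2
    refine ⟨w, ?_, hw.symm⟩
    have hN := eisNorm_mul u x
    rw [← hv, hw, eisNorm_smul, hu, show eisNorm x = n from hx] at hN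
    exact mul_left_cancel₀ hp.ne_zero (by rw [← hN]; ring)
  · rintro ⟨w, hw, rfl⟩
    simp only [Set.mem_ofPred_eq] at hw
    refine ⟨⟨eisMul (eisConj u) w, ?_, ?_⟩, eisMul u w, ?_, ?_⟩
    · simp only [eisReps, Set.mem_ofPred_eq, eisNorm_mul, eisNorm_conj, hu, hw]
    · rw [eisMul_mul_conj, hu]
    · simp only [eisReps, Set.mem_ofPred_eq, eisNorm_mul, hu, hw]
    · rw [eisMul_conj_mul, hu]

theorem ncard_eisReps_mul_add {p : ℤ} (hp : Prime p) {u : ℤ × ℤ} (hu : eisNorm u = p)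
    (h2 : ¬ p ∣ 2) (h3 : ¬ p ∣ 3) (n : ℤ) :
    (eisReps (p * n)).ncard + {v | p * eisNorm v = n}.ncard = 2 * (eisReps n).ncard := by
  rw [← Set.ncard_image_of_injective {v | p * eisNorm v = n} (smul_int_prod_injective hp.ne_zero),
    ← eisMul_image_inter hp hu h2 h3, eisReps_mul_eq_union hp hu,
    Set.ncard_union_add_ncard_inter _ _ ((eisReps_finite n).image _) ((eisReps_finite n).image _),
    Set.ncard_image_of_injective _ (eisMul_injective (by rw [hu]; exact hp.ne_zero)),
    Set.ncard_image_of_injective _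
      (eisMul_injective (by rw [eisNorm_conj, hu]; exact hp.ne_zero)), two_mul]

theorem exists_sq_add_self_add_one_eq_zero {p : ℕ} [Fact p.Prime] (h : p % 3 = 1) :
    ∃ z : ZMod p, z ^ 2 + z + 1 = 0 := by
  have : Fact (Nat.Prime 3) := ⟨Nat.prime_three⟩
  have hc : 3 ∣ Fintype.card (ZMod p)ˣ := by
    rw [ZMod.card_units]; omega
  obtain ⟨u, hu⟩ := exists_prime_orderOf_dvd_card 3 hc
  have h3 : (u : ZMod p) ^ 3 = 1 := by
    rw [← Units.val_pow_eq_pow_val, ← hu, pow_orderOf_eq_one, Units.val_one]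
  have h1 : (u : ZMod p) - 1 ≠ 0 := by
    intro h
    have : u = 1 := Units.ext (by simpa using sub_eq_zero.1 h)
    rw [this, orderOf_one] at hu
    omega
  exact ⟨u, mul_left_cancel₀ h1 (by linear_combination h3)⟩

theorem sq_add_self_add_one_ne_zero {p : ℕ} [Fact p.Prime] (h : p % 3 = 2) (z : ZMod p) :
    z ^ 2 + z + 1 ≠ 0 := by
  intro hz
  have h3 : z ^ 3 = 1 := by linear_combination (z - 1) * hz
  have h0 : z ≠ 0 := by rintro rfl; simp at h3
  have hd := ZMod.orderOf_dvd_card_sub_one h0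
  have hd3 : orderOf z ∣ 3 := orderOf_dvd_of_pow_eq_one h3
  rcases (Nat.dvd_prime Nat.prime_three).1 hd3 with h1 | h1
  · rw [orderOf_eq_one_iff] at h1
    rw [h1] at hz
    have : ((3 : ℕ) : ZMod p) = 0 := by push_cast; linear_combination hz
    rw [ZMod.natCast_eq_zero_iff, Nat.dvd_prime Nat.prime_three] at this
    have := (Fact.out : p.Prime).one_lt
    omega
  · rw [h1] at hd
    have := (Fact.out : p.Prime).one_lt
    omega

theorem dvd_and_dvd_of_dvd_eisNorm {p : ℕ} (hp : p.Prime) (h : p % 3 = 2) (v : ℤ × ℤ)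
    (hv : (p : ℤ) ∣ eisNorm v) : (p : ℤ) ∣ v.1 ∧ (p : ℤ) ∣ v.2 := by
  have : Fact p.Prime := ⟨hp⟩
  have h' := (ZMod.intCast_zmod_eq_zero_iff_dvd _ p).2 hv
  simp only [eisNorm, Int.cast_add, Int.cast_mul, Int.cast_pow] at h'
  rw [← ZMod.intCast_zmod_eq_zero_iff_dvd, ← ZMod.intCast_zmod_eq_zero_iff_dvd]
  have h2 : (v.2 : ZMod p) = 0 := by
    by_contra h0
    refine sq_add_self_add_one_ne_zero h ((v.1 : ZMod p) / v.2) ?_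
    field_simp
    linear_combination h'
  rw [h2] at h'
  exact ⟨by simpa using h', h2⟩

/-- Thue's lemma: a linear congruence modulo `p` has a small nonzero solution. -/
theorem exists_small_intCast_eq_mul {p : ℕ} [NeZero p] (z : ZMod p) :
    ∃ v : ℤ × ℤ, v ≠ 0 ∧ v.1 ^ 2 ≤ p ∧ v.2 ^ 2 ≤ p ∧ (v.1 : ZMod p) = z * v.2 := by
  set s := Nat.sqrt p with hs
  let f : Fin (s + 1) × Fin (s + 1) → ZMod p := fun x => (x.1 : ℕ) - z * (x.2 : ℕ)
  have hcard : Fintype.card (ZMod p) < Fintype.card (Fin (s + 1) × Fin (s + 1)) := by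
    rw [ZMod.card, Fintype.card_prod, Fintype.card_fin]
    exact Nat.lt_succ_sqrt p
  obtain ⟨x, y, hxy, hf⟩ := Fintype.exists_ne_map_eq_of_card_lt f hcard
  have hb (a b : Fin (s + 1)) : ((a : ℤ) - (b : ℤ)) ^ 2 ≤ p := by
    have h1 : |(a : ℤ) - (b : ℤ)| ≤ s := by
      rw [abs_le]; omega
    have h2 : ((s : ℤ)) * s ≤ p := by exact_mod_cast Nat.sqrt_le p
    rw [← sq_abs]
    nlinarith [abs_nonneg ((a : ℤ) - (b : ℤ))]
  refine ⟨((x.1 : ℤ) - (y.1 : ℤ), (x.2 : ℤ) - (y.2 : ℤ)), ?_, hb _ _, hb _ _, ?_⟩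
  · intro h
    rw [Prod.mk_eq_zero] at h
    apply hxy
    ext <;> omega
  · simp only [f] at hf
    push_cast
    linear_combination hf

theorem exists_eisNorm_eq_prime {p : ℕ} (hp : p.Prime) (h : p % 3 = 1) :
    ∃ u, eisNorm u = p := by
  have : Fact p.Prime := ⟨hp⟩
  obtain ⟨z, hz⟩ := exists_sq_add_self_add_one_eq_zero h
  obtain ⟨v, hv0, h1, h2, hv⟩ := exists_small_intCast_eq_mul z
  have hd : (p : ℤ) ∣ eisNorm v := by
    rw [← ZMod.intCast_zmod_eq_zero_iff_dvd]
    simp only [eisNorm, Int.cast_add, Int.cast_mul, Int.cast_pow]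
    rw [hv]
    linear_combination (v.2 : ZMod p) ^ 2 * hz
  obtain ⟨k, hk⟩ := hd
  have hp0 : (0 : ℤ) < p := by exact_mod_cast hp.pos
  have hne (x : ℤ) : x ^ 2 ≠ p := by
    intro hx
    have := (Nat.prime_iff_prime_int.1 hp).irreducible
    exact this.not_isSquare ⟨x, by rw [← hx, sq]⟩
  have h1' := lt_of_le_of_ne h1 (hne _)
  have h2' := lt_of_le_of_ne h2 (hne _)
  have hpos : 0 < eisNorm v := by
    refine lt_of_le_of_ne (eisNorm_nonneg v) fun h0 => hv0 ?_
    have := abs_add_abs_le_eisNorm v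
    rw [← h0] at this
    have a1 := abs_nonneg v.1
    have a2 := abs_nonneg v.2
    exact Prod.ext (abs_eq_zero.1 (by linarith)) (abs_eq_zero.1 (by linarith))
  have hlt : eisNorm v < 3 * p := by
    simp only [eisNorm]
    nlinarith [sq_nonneg (v.1 - v.2)]
  have hk0 : 0 < k := by
    rw [hk] at hpos; exact (pos_iff_pos_of_mul_pos hpos).1 hp0
  have hk3 : k < 3 := by rw [hk] at hlt; nlinarith
  obtain rfl | rfl : k = 1 ∨ k = 2 := by omega
  · exact ⟨v, by rw [hk, mul_one]⟩
  · exfalso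
    obtain ⟨d1, d2⟩ := dvd_and_dvd_of_dvd_eisNorm Nat.prime_two rfl v ⟨p, by rw [hk]; push_cast; ring⟩
    obtain ⟨w, rfl⟩ := exists_smul_of_dvd d1 d2
    rw [eisNorm_smul] at hk
    have : p = 2 := ((Nat.prime_dvd_prime_iff_eq Nat.prime_two hp).1 (by
      zify; exact ⟨eisNorm w, by push_cast at hk; linarith⟩)).symm
    omega

theorem legendreSym_three_eq_one {n : ℕ} (h : n % 3 = 1) : legendreSym 3 n = 1 := by
  rw [legendreSym.mod, show (n : ℤ) % (3 : ℕ) = 1 by omega]; decide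

theorem legendreSym_three_eq_neg_one {n : ℕ} (h : n % 3 = 2) : legendreSym 3 n = -1 := by
  rw [legendreSym.mod, show (n : ℤ) % (3 : ℕ) = 2 by omega]; decide

theorem legendreSym_three_eq_zero {n : ℕ} (h : n % 3 = 0) : legendreSym 3 n = 0 := by
  rw [legendreSym.mod, show (n : ℤ) % (3 : ℕ) = 0 by omega]; decide

theorem divisors_prime_mul {p : ℕ} (hp : p.Prime) {n : ℕ} (hn : n ≠ 0) :
    (p * n).divisors = n.divisors ∪ n.divisors.image (p * ·) := by
  ext d
  simp only [Finset.mem_union, Finset.mem_image, Nat.mem_divisors]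
  constructor
  · rintro ⟨hd, -⟩
    by_cases h : p ∣ d
    · obtain ⟨e, rfl⟩ := h
      exact Or.inr ⟨e, ⟨Nat.dvd_of_mul_dvd_mul_left hp.pos hd, hn⟩, rfl⟩
    · exact Or.inl ⟨((hp.coprime_iff_not_dvd.2 h).symm.dvd_of_dvd_mul_left hd), hn⟩
  · rintro (⟨hd, -⟩ | ⟨e, ⟨he, -⟩, rfl⟩)
    · exact ⟨hd.mul_left _, mul_ne_zero hp.ne_zero hn⟩
    · exact ⟨Nat.mul_dvd_mul_left _ he, mul_ne_zero hp.ne_zero hn⟩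

theorem sum_image_mul_legendreSym {p : ℕ} (hp : p.Prime) (n : ℕ) :
    ∑ d ∈ n.divisors.image (p * ·), legendreSym 3 d = legendreSym 3 p * divisorSumChi n := by
  rw [Finset.sum_image fun x _ y _ h => Nat.eq_of_mul_eq_mul_left hp.pos h, divisorSumChi,
    Finset.mul_sum]
  exact Finset.sum_congr rfl fun d _ => by rw [Nat.cast_mul, legendreSym.mul]

theorem divisorSumChi_prime_mul {p : ℕ} (hp : p.Prime) {n : ℕ} (hn : ¬ p ∣ n) :
    divisorSumChi (p * n) = (1 + legendreSym 3 p) * divisorSumChi n := by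
  have hn0 : n ≠ 0 := by rintro rfl; exact hn (dvd_zero _)
  rw [divisorSumChi, divisors_prime_mul hp hn0, Finset.sum_union, sum_image_mul_legendreSym hp,
    divisorSumChi]
  · ring
  · rw [Finset.disjoint_left]
    intro d hd hd'
    obtain ⟨e, -, rfl⟩ := Finset.mem_image.1 hd'
    exact hn (dvd_of_mul_right_dvd (Nat.dvd_of_mem_divisors hd))

theorem divisorSumChi_prime_mul_prime_mul {p : ℕ} (hp : p.Prime) {n : ℕ} (hn : n ≠ 0) :
    divisorSumChi (p * (p * n)) + legendreSym 3 p * divisorSumChi n =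
      (1 + legendreSym 3 p) * divisorSumChi (p * n) := by
  have hpn : p * n ≠ 0 := mul_ne_zero hp.ne_zero hn
  have hi : (p * n).divisors ∩ (p * n).divisors.image (p * ·) = n.divisors.image (p * ·) := by
    ext d
    simp only [Finset.mem_inter, Finset.mem_image, Nat.mem_divisors]
    constructor
    · rintro ⟨⟨hd, -⟩, e, -, rfl⟩
      exact ⟨e, ⟨Nat.dvd_of_mul_dvd_mul_left hp.pos hd, hn⟩, rfl⟩
    · rintro ⟨e, ⟨he, -⟩, rfl⟩
      exact ⟨⟨Nat.mul_dvd_mul_left _ he, hpn⟩, e, ⟨he.mul_left _, hpn⟩, rfl⟩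
  have := Finset.sum_union_inter (s₁ := (p * n).divisors)
    (s₂ := (p * n).divisors.image (p * ·)) (f := fun d => legendreSym 3 d)
  rw [hi, ← divisors_prime_mul hp hpn, sum_image_mul_legendreSym hp,
    sum_image_mul_legendreSym hp] at this
  simp only [divisorSumChi] at this ⊢
  linear_combination this

theorem ncard_eisReps_prime_mul {p : ℕ} (hp : p.Prime) {n : ℕ} (hn : ¬ p ∣ n) :
    ((eisReps ((p * n : ℕ) : ℤ)).ncard : ℤ) =
      (1 + legendreSym 3 p) * (eisReps n).ncard := by
  have hpi := Nat.prime_iff_prime_int.1 hp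
  push_cast
  obtain h | h | h : p % 3 = 0 ∨ p % 3 = 1 ∨ p % 3 = 2 := by omega
  · obtain rfl : p = 3 := ((Nat.prime_dvd_prime_iff_eq Nat.prime_three hp).1
      (Nat.dvd_of_mod_eq_zero h)).symm
    rw [legendreSym_three_eq_zero h, Nat.cast_ofNat, ncard_eisReps_three_mul]
    ring
  · obtain ⟨u, hu⟩ := exists_eisNorm_eq_prime hp h
    have := ncard_eisReps_mul_add hpi hu
      (by norm_cast; rw [Nat.prime_dvd_prime_iff_eq hp Nat.prime_two]; omega)
      (by norm_cast; rw [Nat.prime_dvd_prime_iff_eq hp Nat.prime_three]; omega) n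
    have he : {v | (p : ℤ) * eisNorm v = n} = ∅ := by
      rw [Set.eq_empty_iff_forall_notMem]
      intro v hv
      exact hn (Int.natCast_dvd_natCast.1 ⟨eisNorm v, hv.symm⟩)
    rw [he, Set.ncard_empty] at this
    rw [legendreSym_three_eq_one h]
    zify at this
    linarith
  · rw [legendreSym_three_eq_neg_one h, eisReps_mul_of_forall_dvd hpi.ne_zero
      (by exact_mod_cast hn) (dvd_and_dvd_of_dvd_eisNorm hp h)]
    simp

theorem ncard_eisReps_prime_mul_prime_mul {p : ℕ} (hp : p.Prime) (n : ℕ) :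
    ((eisReps ((p * (p * n) : ℕ) : ℤ)).ncard : ℤ) + legendreSym 3 p * (eisReps n).ncard =
      (1 + legendreSym 3 p) * (eisReps ((p * n : ℕ) : ℤ)).ncard := by
  have hpi := Nat.prime_iff_prime_int.1 hp
  push_cast
  obtain h | h | h : p % 3 = 0 ∨ p % 3 = 1 ∨ p % 3 = 2 := by omega
  · obtain rfl : p = 3 := ((Nat.prime_dvd_prime_iff_eq Nat.prime_three hp).1
      (Nat.dvd_of_mod_eq_zero h)).symm
    rw [legendreSym_three_eq_zero h, Nat.cast_ofNat, ncard_eisReps_three_mul (3 * n)]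
    ring
  · obtain ⟨u, hu⟩ := exists_eisNorm_eq_prime hp h
    have := ncard_eisReps_mul_add hpi hu
      (by norm_cast; rw [Nat.prime_dvd_prime_iff_eq hp Nat.prime_two]; omega)
      (by norm_cast; rw [Nat.prime_dvd_prime_iff_eq hp Nat.prime_three]; omega) (p * n)
    have he : {v | (p : ℤ) * eisNorm v = p * n} = eisReps n := by
      ext v
      simp [eisReps, hp.ne_zero]
    rw [he] at this
    rw [legendreSym_three_eq_one h]
    zify at this
    linarith
  · rw [legendreSym_three_eq_neg_one h, eisReps_sq_mul_of_forall_dvd hpi.ne_zero _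
      (dvd_and_dvd_of_dvd_eisNorm hp h)]
    ring

/-- The number of representations of `n` by `a² + ab + b²` is `6 ∑_{d ∣ n} χ₃(d)`. -/
theorem ncard_eisReps_eq (n : ℕ) (hn : n ≠ 0) :
    ((eisReps n).ncard : ℤ) = 6 * divisorSumChi n := by
  induction n using Nat.strong_induction_on with
  | _ n ih =>
    by_cases h1 : n = 1
    · subst h1
      rw [Nat.cast_one, ncard_eisReps_one]
      simp [divisorSumChi]
    obtain ⟨p, hp, m, rfl⟩ := Nat.exists_prime_and_dvd h1
    have hm : m ≠ 0 := by rintro rfl; simp at hn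
    have hlt (k : ℕ) (hk : k ≠ 0) : k < p * k :=
      lt_mul_of_one_lt_left (Nat.pos_of_ne_zero hk) hp.one_lt
    by_cases hpm : p ∣ m
    · obtain ⟨k, rfl⟩ := hpm
      have hk : k ≠ 0 := by rintro rfl; simp at hm
      have e1 := ncard_eisReps_prime_mul_prime_mul hp k
      have e2 := divisorSumChi_prime_mul_prime_mul hp hk
      rw [ih _ (hlt _ hm) hm, ih _ ((hlt _ hk).trans (hlt _ hm)) hk] at e1
      linear_combination e1 - 6 * e2
    · rw [ncard_eisReps_prime_mul hp hpm, divisorSumChi_prime_mul hp hpm, ih _ (hlt _ hm) hm]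
      ring

theorem natCast_toNat_eisNorm (v : ℤ × ℤ) : ((eisNorm v).toNat : ℤ) = eisNorm v :=
  Int.toNat_of_nonneg (eisNorm_nonneg v)

theorem summable_pow_natAbs {r : ℝ} (h0 : 0 ≤ r) (h1 : r < 1) :
    Summable fun n : ℤ => r ^ n.natAbs := by
  refine summable_int_iff_summable_nat_and_neg.2 ⟨?_, ?_⟩ <;>
    simpa using summable_geometric_of_lt_one h0 h1

theorem summable_norm_pow_eisNorm {q : ℂ} (hq : ‖q‖ < 1) :
    Summable fun v : ℤ × ℤ => ‖q ^ (eisNorm v).toNat‖ := by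
  set r := √‖q‖ with hr
  have h0 : 0 ≤ r := Real.sqrt_nonneg _
  have h1 : r < 1 := by rw [hr, Real.sqrt_lt' one_pos]; simpa using hq
  have hs := summable_pow_natAbs h0 h1
  refine Summable.of_nonneg_of_le (fun _ => norm_nonneg _) (fun v => ?_)
    (hs.mul_of_nonneg hs (fun _ => by positivity) fun _ => by positivity)
  rw [norm_pow, ← Real.sq_sqrt (norm_nonneg q), ← hr, ← pow_mul, ← pow_add]
  refine pow_le_pow_of_le_one h0 h1.le ?_
  have := abs_add_abs_le_eisNorm v
  have := natCast_toNat_eisNorm v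
  rw [Int.abs_eq_natAbs, Int.abs_eq_natAbs] at *
  omega

theorem summable_norm_pow_sq {q : ℂ} (hq : ‖q‖ < 1) :
    Summable fun n : ℤ => ‖q ^ (n ^ 2)‖ := by
  refine Summable.of_nonneg_of_le (fun _ => norm_nonneg _) (fun n => ?_)
    (summable_pow_natAbs (norm_nonneg q) hq)
  rw [← Int.natAbs_sq, ← Int.natCast_pow, zpow_natCast, norm_pow]
  exact pow_le_pow_of_le_one (norm_nonneg q) hq.le (Nat.le_self_pow two_ne_zero _)

theorem norm_legendreSym_three_le (n : ℕ) : ‖(legendreSym 3 n : ℂ)‖ ≤ 1 := by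
  obtain h | h | h : n % 3 = 0 ∨ n % 3 = 1 ∨ n % 3 = 2 := by omega
  · simp [legendreSym_three_eq_zero h]
  · simp [legendreSym_three_eq_one h]
  · simp [legendreSym_three_eq_neg_one h]

theorem summable_legendreSym_mul_pow {q : ℂ} (hq : ‖q‖ < 1) :
    Summable fun c : ℕ+ × ℕ+ => (legendreSym 3 (c.1 : ℕ) : ℂ) * q ^ (c.1 * c.2 : ℕ) := by
  have := (summable_prod_mul_pow 0 hq).norm
  refine Summable.of_norm_bounded this fun c => ?_
  rw [norm_mul, pow_zero, one_mul]
  exact mul_le_of_le_one_left (norm_nonneg _) (norm_legendreSym_three_le _)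

theorem tsum_pnat_pow_mul {q : ℂ} (hq : ‖q‖ < 1) (d : ℕ+) :
    ∑' c : ℕ+, q ^ (d * c : ℕ) = q ^ (d : ℕ) / (1 - q ^ (d : ℕ)) := by
  have h : ‖q ^ (d : ℕ)‖ < 1 := by
    rw [norm_pow]; exact pow_lt_one₀ (norm_nonneg _) hq d.ne_zero
  rw [tsum_pnat_eq_tsum_succ (f := fun c => q ^ (d * c : ℕ))]
  simp_rw [mul_add, mul_one, pow_add, pow_mul]
  rw [tsum_mul_right, tsum_geometric_of_norm_lt_one h]
  ring

theorem summable_lambert {q : ℂ} (hq : ‖q‖ < 1) :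
    Summable fun j : ℕ =>
      (legendreSym 3 ((j : ℤ) + 1) : ℂ) * (q ^ (j + 1) / (1 - q ^ (j + 1))) := by
  have h := (summable_legendreSym_mul_pow hq).prod
  simp_rw [tsum_mul_left, tsum_pnat_pow_mul hq] at h
  have := summable_pnat_iff_summable_succ (f := fun j : ℕ =>
    (legendreSym 3 (j : ℤ) : ℂ) * (q ^ j / (1 - q ^ j))) |>.1 h
  simpa using this

theorem tsum_lambert_eq {q : ℂ} (hq : ‖q‖ < 1) :
    ∑' j : ℕ, (legendreSym 3 ((j : ℤ) + 1) : ℂ) * (q ^ (j + 1) / (1 - q ^ (j + 1))) =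
      ∑' n : ℕ+, (divisorSumChi n : ℂ) * q ^ (n : ℕ) := by
  have hs := summable_legendreSym_mul_pow hq
  have h1 := hs.tsum_prod
  simp_rw [tsum_mul_left, tsum_pnat_pow_mul hq] at h1
  rw [tsum_pnat_eq_tsum_succ (f := fun j : ℕ =>
    (legendreSym 3 (j : ℤ) : ℂ) * (q ^ j / (1 - q ^ j)))] at h1
  have hs' := sigmaAntidiagonalEquivProd.summable_iff.2 hs
  rw [← sigmaAntidiagonalEquivProd.tsum_eq] at h1
  simp only [Nat.cast_add, Nat.cast_one] at h1
  rw [← h1]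
  refine hs'.tsum_sigma.trans (tsum_congr fun n => ?_)
  rw [tsum_fintype, divisorSumChi, Int.cast_sum, Finset.sum_mul,
    ← Nat.sum_divisorsAntidiagonal (fun d _ => (legendreSym 3 (d : ℤ) : ℂ) * q ^ (n : ℕ)),
    ← Finset.sum_coe_sort (n : ℕ).divisorsAntidiagonal
      fun x => (legendreSym 3 (x.1 : ℤ) : ℂ) * q ^ (n : ℕ)]
  refine Finset.sum_congr rfl fun x _ => ?_
  have := divisorsAntidiagonalFactors_eq x
  simp only [Function.comp, sigmaAntidiagonalEquivProd]
  erw [this]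
  rfl

theorem tsum_pow_eisNorm {q : ℂ} (hq : ‖q‖ < 1) :
    ∑' v : ℤ × ℤ, q ^ (eisNorm v).toNat =
      1 + 6 * ∑' n : ℕ+, (divisorSumChi n : ℂ) * q ^ (n : ℕ) := by
  let e := Equiv.sigmaFiberEquiv fun v : ℤ × ℤ => (eisNorm v).toNat
  have hs : Summable fun v : ℤ × ℤ => q ^ (eisNorm v).toNat :=
    (summable_norm_pow_eisNorm hq).of_norm
  have hs' := e.summable_iff.2 hs
  have hf (n : ℕ) : ∑' x : {v : ℤ × ℤ // (eisNorm v).toNat = n},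
      ((fun v : ℤ × ℤ => q ^ (eisNorm v).toNat) ∘ e) ⟨n, x⟩ = (eisReps n).ncard * q ^ n := by
    have : ∀ x : {v : ℤ × ℤ // (eisNorm v).toNat = n},
        ((fun v : ℤ × ℤ => q ^ (eisNorm v).toNat) ∘ e) ⟨n, x⟩ = q ^ n := by
      rintro ⟨v, hv⟩
      simp [e, Equiv.sigmaFiberEquiv, hv]
    simp_rw [this]
    rw [tsum_const, nsmul_eq_mul]
    congr 2
    rw [← Nat.card_coe_set_eq]
    refine Nat.card_congr (Equiv.subtypeEquivRight fun v => ?_)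
    have := natCast_toNat_eisNorm v
    change _ ↔ eisNorm v = n
    omega
  have hsn : Summable fun n : ℕ => ((eisReps n).ncard : ℂ) * q ^ n := by
    simpa only [hf] using hs'.sigma
  rw [← e.tsum_eq]
  erw [hs'.tsum_sigma]
  simp_rw [hf]
  rw [← tsum_zero_pnat_eq_tsum_nat hsn, ← tsum_mul_left]
  congr 1
  · have : eisReps (0 : ℕ) = {0} := by
      ext v
      constructor
      · intro hv
        have h := abs_add_abs_le_eisNorm v
        rw [show eisNorm v = 0 from hv] at h
        have a1 := abs_nonneg v.1
        have a2 := abs_nonneg v.2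
        exact Prod.ext (abs_eq_zero.1 (by linarith)) (abs_eq_zero.1 (by linarith))
      · rintro rfl
        simp [eisReps, eisNorm]
    rw [this]
    simp
  · refine tsum_congr fun n => ?_
    have := ncard_eisReps_eq n n.ne_zero
    rw [← mul_assoc]
    congr 1
    exact_mod_cast this

theorem tsum_even_snd_pow_eisNorm {q : ℂ} (hq : ‖q‖ < 1) :
    ∑' v : ℤ × ℤ, (if Even v.2 then q ^ (eisNorm v).toNat else 0) =
      (∑' n : ℤ, q ^ (n ^ 2)) * ∑' n : ℤ, (q ^ 3) ^ (n ^ 2) := by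
  have hq3 : ‖q ^ 3‖ < 1 := by
    rw [norm_pow]; exact pow_lt_one₀ (norm_nonneg _) hq three_ne_zero
  rw [tsum_mul_tsum_of_summable_norm (summable_norm_pow_sq hq) (summable_norm_pow_sq hq3)]
  have hi : Function.Injective fun v : ℤ × ℤ => (v.1 - v.2, 2 * v.2) := by
    intro v w h
    simp only [Prod.mk.injEq] at h
    ext <;> omega
  rw [← hi.tsum_eq]
  · refine tsum_congr fun v => ?_
    have hN : eisNorm (v.1 - v.2, 2 * v.2) = v.1 ^ 2 + 3 * v.2 ^ 2 := by
      simp only [eisNorm]; ring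
    rw [if_pos (even_two_mul _), hN]
    have h1 : (v.1 ^ 2 + 3 * v.2 ^ 2).toNat = v.1.natAbs ^ 2 + 3 * v.2.natAbs ^ 2 := by
      rw [← Int.natAbs_sq v.1, ← Int.natAbs_sq v.2]
      exact Int.toNat_natCast (v.1.natAbs ^ 2 + 3 * v.2.natAbs ^ 2)
    rw [h1, ← Int.natAbs_sq v.1, ← Int.natAbs_sq v.2, ← Int.natCast_pow, ← Int.natCast_pow,
      zpow_natCast, zpow_natCast, pow_add, pow_mul q 3]
  · intro v hv
    have h2 : Even v.2 := by
      by_contra h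
      simp [h] at hv
    obtain ⟨k, hk⟩ := h2
    exact ⟨(v.1 + k, k), Prod.ext (by simp) (by simp [hk, two_mul])⟩

theorem tsum_even_even_pow_eisNorm (q : ℂ) :
    ∑' v : ℤ × ℤ, (if Even v.1 ∧ Even v.2 then q ^ (eisNorm v).toNat else 0) =
      ∑' v : ℤ × ℤ, (q ^ 4) ^ (eisNorm v).toNat := by
  rw [← (smul_int_prod_injective two_ne_zero).tsum_eq]
  · refine tsum_congr fun v => ?_
    rw [if_pos ⟨even_two_mul _, even_two_mul _⟩, eisNorm_smul, ← pow_mul,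
      Int.toNat_mul (by norm_num) (eisNorm_nonneg v)]
    rfl
  · intro v hv
    have h2 : Even v.1 ∧ Even v.2 := by
      by_contra h
      simp [h] at hv
    obtain ⟨w, hw⟩ := exists_smul_of_dvd h2.1.two_dvd h2.2.two_dvd
    exact ⟨w, hw.symm⟩

/-- The automorphism of the Eisenstein integers given by multiplication by `ω`. -/
def eisRotate : ℤ × ℤ ≃ ℤ × ℤ where
  toFun v := (-v.2, v.1 + v.2)
  invFun v := (v.1 + v.2, -v.1)
  left_inv v := by ext <;> simp
  right_inv v := by ext <;> simp

theorem eisNorm_rotate (v : ℤ × ℤ) : eisNorm (eisRotate v) = eisNorm v := by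
  simp only [eisNorm, eisRotate, Equiv.coe_fn_mk]; ring

theorem three_mul_theta_mul_theta {q : ℂ} (hq : ‖q‖ < 1) :
    3 * ((∑' n : ℤ, q ^ (n ^ 2)) * ∑' n : ℤ, (q ^ 3) ^ (n ^ 2)) =
      ∑' v : ℤ × ℤ, q ^ (eisNorm v).toNat + 2 * ∑' v : ℤ × ℤ, (q ^ 4) ^ (eisNorm v).toNat := by
  set g : ℤ × ℤ → ℂ := fun v => q ^ (eisNorm v).toNat with hg
  have hs := summable_norm_pow_eisNorm hq
  have hS (P : ℤ × ℤ → Prop) [DecidablePred P] : Summable fun v => if P v then g v else 0 := by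
    refine Summable.of_norm_bounded hs fun v => ?_
    split_ifs
    · exact le_rfl
    · simp
  have hr (v : ℤ × ℤ) : g (eisRotate v) = g v := by simp only [hg, eisNorm_rotate]
  have e1 : ∑' v : ℤ × ℤ, (if Even v.2 then g v else 0) =
      ∑' v : ℤ × ℤ, (if Even v.1 then g v else 0) := by
    rw [← eisRotate.tsum_eq fun v : ℤ × ℤ => if Even v.1 then g v else 0]
    simp only [hr]
    simp [eisRotate]
  have e2 : ∑' v : ℤ × ℤ, (if Even (v.1 + v.2) then g v else 0) =
      ∑' v : ℤ × ℤ, (if Even v.2 then g v else 0) := by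
    rw [← eisRotate.tsum_eq fun v : ℤ × ℤ => if Even v.2 then g v else 0]
    simp only [hr]
    rfl
  have key : ∑' v : ℤ × ℤ, (if Even v.1 then g v else 0) +
      ∑' v : ℤ × ℤ, (if Even v.2 then g v else 0) +
      ∑' v : ℤ × ℤ, (if Even (v.1 + v.2) then g v else 0) =
      ∑' v : ℤ × ℤ, g v + 2 * ∑' v : ℤ × ℤ, (if Even v.1 ∧ Even v.2 then g v else 0) := by
    rw [← (hS fun v => Even v.1).tsum_add (hS fun v => Even v.2),
      ← ((hS fun v => Even v.1).add (hS fun v => Even v.2)).tsum_add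
        (hS fun v => Even (v.1 + v.2)), ← tsum_mul_left,
      ← hs.of_norm.tsum_add ((hS fun v => Even v.1 ∧ Even v.2).mul_left 2)]
    refine tsum_congr fun v => ?_
    by_cases h1 : Even v.1 <;> by_cases h2 : Even v.2 <;> simp [h1, h2, Int.even_add, hg]
    ring
  rw [e2, ← e1, tsum_even_snd_pow_eisNorm hq, tsum_even_even_pow_eisNorm] at key
  linear_combination key

theorem statement0 (q : ℂ) (hq : ‖q‖ < 1) :
    (∑' n : ℤ, (q) ^ (n ^ 2)) * (∑' n : ℤ, (q ^ 3) ^ (n ^ 2)) =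
      1 + 2 * ∑' j : ℕ, (legendreSym 3 ((j : ℤ) + 1) : ℂ) * (q ^ (1 * (j + 1)) / (1 - q ^ (1 * (j + 1))) + 2 * q ^ (4 * (j + 1)) / (1 - q ^ (4 * (j + 1)))) := by
  have hq4 : ‖q ^ 4‖ < 1 := by
    rw [norm_pow]; exact pow_lt_one₀ (norm_nonneg _) hq four_ne_zero
  have h := three_mul_theta_mul_theta hq
  rw [tsum_pow_eisNorm hq, tsum_pow_eisNorm hq4, ← tsum_lambert_eq hq,
    ← tsum_lambert_eq hq4] at h
  have hsplit : ∑' j : ℕ, (legendreSym 3 ((j : ℤ) + 1) : ℂ) * (q ^ (1 * (j + 1)) /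
      (1 - q ^ (1 * (j + 1))) + 2 * q ^ (4 * (j + 1)) / (1 - q ^ (4 * (j + 1)))) =
      ∑' j : ℕ, (legendreSym 3 ((j : ℤ) + 1) : ℂ) * (q ^ (j + 1) / (1 - q ^ (j + 1))) +
      2 * ∑' j : ℕ, (legendreSym 3 ((j : ℤ) + 1) : ℂ) *
        ((q ^ 4) ^ (j + 1) / (1 - (q ^ 4) ^ (j + 1))) := by
    rw [← tsum_mul_left, ← (summable_lambert hq).tsum_add ((summable_lambert hq4).mul_left 2)]
    refine tsum_congr fun j => ?_
    rw [one_mul, pow_mul q 4]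
    ring
  rw [hsplit]
  linear_combination h / 3
end
end

section
/- For |q|<1, q·ψ(q²)·ψ(q⁶) = ∑_{j≥1} χ₃(j)·( q^j/(1−q^j) − q^{4j}/(1−q^{4j}) ), where χ₃ is the Legendre symbol mod 3. -/
noncomputable section

/-- The coefficient `∑_{d ∣ n} χ₃(d)` of the Lambert series of the Legendre symbol mod 3. -/
def lambertCoeff (n : ℕ) : ℤ := ∑ d ∈ n.divisors, legendreSym 3 d

lemma filter_not_dvd_divisors_prime_mul {p m : ℕ} (hp : p.Prime) (hm : m ≠ 0) :
    ((p * m).divisors.filter fun d => ¬ p ∣ d) = m.divisors.filter fun d => ¬ p ∣ d := by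
  ext d
  simp only [Nat.mem_divisors, Finset.mem_filter]
  constructor
  · rintro ⟨⟨h, -⟩, hd⟩
    exact ⟨⟨((Nat.Prime.coprime_iff_not_dvd hp).2 hd).symm.dvd_of_dvd_mul_left h, hm⟩, hd⟩
  · rintro ⟨⟨h, -⟩, hd⟩
    exact ⟨⟨h.mul_left p, mul_ne_zero hp.ne_zero hm⟩, hd⟩

lemma lambertCoeff_prime_mul {p m : ℕ} (hp : p.Prime) (hm : m ≠ 0) :
    lambertCoeff (p * m) = legendreSym 3 p * lambertCoeff m +
      ∑ d ∈ m.divisors with ¬ p ∣ d, legendreSym 3 d := by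
  unfold lambertCoeff
  rw [← Finset.sum_filter_add_sum_filter_not (p * m).divisors (fun d => p ∣ d)]
  congr 1
  · rw [Finset.mul_sum]
    symm
    refine Finset.sum_bij (fun d _ => p * d) ?_ ?_ ?_ ?_
    · intro d hd
      simp only [Nat.mem_divisors, Finset.mem_filter] at hd ⊢
      exact ⟨⟨mul_dvd_mul_left p hd.1, mul_ne_zero hp.ne_zero hm⟩, dvd_mul_right p d⟩
    · intro a _ b _ h
      exact Nat.eq_of_mul_eq_mul_left hp.pos h
    · intro b hb
      simp only [Nat.mem_divisors, Finset.mem_filter] at hb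
      obtain ⟨⟨hb, -⟩, c, rfl⟩ := hb
      exact ⟨c, by simpa [hm] using (Nat.mul_dvd_mul_iff_left hp.pos).1 hb, rfl⟩
    · intro d _
      rw [Nat.cast_mul, legendreSym.mul]
  · rw [filter_not_dvd_divisors_prime_mul hp hm]

lemma lambertCoeff_prime_mul_of_not_dvd {p m : ℕ} (hp : p.Prime) (hm : m ≠ 0) (h : ¬ p ∣ m) :
    lambertCoeff (p * m) = (1 + legendreSym 3 p) * lambertCoeff m := by
  rw [lambertCoeff_prime_mul hp hm, Finset.filter_true_of_mem]
  · simp only [lambertCoeff]; ring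
  · intro d hd hpd
    exact h (hpd.trans (Nat.dvd_of_mem_divisors hd))

lemma lambertCoeff_prime_mul_prime_mul {p m : ℕ} (hp : p.Prime) (hm : m ≠ 0) :
    lambertCoeff (p * (p * m)) =
      (1 + legendreSym 3 p) * lambertCoeff (p * m) - legendreSym 3 p * lambertCoeff m := by
  rw [lambertCoeff_prime_mul hp (mul_ne_zero hp.ne_zero hm)]
  rw [filter_not_dvd_divisors_prime_mul hp hm]
  linear_combination -lambertCoeff_prime_mul hp hm

/-- The representations of `n` by the form `a² + 3b²`. -/
def normReps (n : ℕ) : Finset (ℤ × ℤ) :=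
  (Finset.Icc (-n : ℤ) n ×ˢ Finset.Icc (-n : ℤ) n).filter fun x => x.1 ^ 2 + 3 * x.2 ^ 2 = n

lemma abs_le_sq (a : ℤ) : |a| ≤ a ^ 2 := by
  rw [← sq_abs]
  exact Int.le_self_sq _

lemma mem_normReps {n : ℕ} {x : ℤ × ℤ} : x ∈ normReps n ↔ x.1 ^ 2 + 3 * x.2 ^ 2 = n := by
  simp only [normReps, Finset.mem_filter, Finset.mem_product, Finset.mem_Icc, and_iff_right_iff_imp]
  intro h
  have h1 : |x.1| ≤ x.1 ^ 2 := abs_le_sq x.1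
  have h2 : |x.2| ≤ x.2 ^ 2 := abs_le_sq x.2
  have := sq_nonneg x.1
  have := sq_nonneg x.2
  exact ⟨abs_le.1 (by linarith), abs_le.1 (by linarith)⟩

/-- The representations of `n` by `a² + 3b²` in which both entries are divisible by `p`. -/
def divReps (p n : ℕ) : Finset (ℤ × ℤ) :=
  (normReps n).filter fun x => (p : ℤ) ∣ x.1 ∧ (p : ℤ) ∣ x.2

lemma divReps_eq_empty {p m : ℕ} (hp : p.Prime) (h : ¬ p ∣ m) : divReps p (p * m) = ∅ := by
  refine Finset.filter_eq_empty_iff.2 ?_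
  rintro ⟨a, b⟩ hx ⟨⟨c, rfl⟩, d, rfl⟩
  rw [mem_normReps] at hx
  apply h
  push_cast at hx
  have h0 : (p : ℤ) ≠ 0 := by exact_mod_cast hp.ne_zero
  have : (p : ℤ) * (c ^ 2 + 3 * d ^ 2) = m := by
    apply mul_left_cancel₀ h0
    linear_combination hx
  exact Int.natCast_dvd_natCast.1 ⟨_, this.symm⟩

lemma card_divReps {p m : ℕ} (hp : p.Prime) :
    (divReps p (p * (p * m))).card = (normReps m).card := by
  have h0 : (p : ℤ) ≠ 0 := by exact_mod_cast hp.ne_zero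
  symm
  refine Finset.card_bij (fun x _ => (p * x.1, p * x.2)) ?_ ?_ ?_
  · intro x hx
    rw [mem_normReps] at hx
    simp only [divReps, Finset.mem_filter, mem_normReps]
    refine ⟨?_, dvd_mul_right _ _, dvd_mul_right _ _⟩
    push_cast
    linear_combination (p : ℤ) ^ 2 * hx
  · rintro ⟨a, b⟩ _ ⟨c, d⟩ _ h
    simpa [hp.ne_zero] using h
  · rintro ⟨a, b⟩ hx
    simp only [divReps, Finset.mem_filter, mem_normReps] at hx
    obtain ⟨hx, ⟨c, rfl⟩, d, rfl⟩ := hx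
    refine ⟨(c, d), ?_, rfl⟩
    rw [mem_normReps]
    push_cast at hx
    apply mul_left_cancel₀ (pow_ne_zero 2 h0)
    linear_combination hx

lemma card_normReps_filter_dvd {p : ℕ} (hp : p.Prime) {u v : ℤ} (huv : u ^ 2 + 3 * v ^ 2 = p)
    (n : ℕ) :
    ((normReps (p * n)).filter fun x => (p : ℤ) ∣ x.2 * u - x.1 * v).card =
      (normReps n).card := by
  have h0 : (p : ℤ) ≠ 0 := by exact_mod_cast hp.ne_zero
  have hp' : Prime (p : ℤ) := Nat.prime_iff_prime_int.1 hp
  symm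
  refine Finset.card_bij (fun x _ => (x.1 * u - 3 * x.2 * v, x.1 * v + x.2 * u)) ?_ ?_ ?_
  · intro x hx
    rw [mem_normReps] at hx
    simp only [Finset.mem_filter, mem_normReps]
    refine ⟨?_, x.2, ?_⟩
    · push_cast
      linear_combination p * hx + (x.1 ^ 2 + 3 * x.2 ^ 2) * huv
    · linear_combination x.2 * huv
  · rintro ⟨a, b⟩ _ ⟨c, d⟩ _ h
    simp only [Prod.mk.injEq] at h ⊢
    constructor <;> apply mul_left_cancel₀ h0
    · linear_combination u * h.1 + 3 * v * h.2 - (a - c) * huv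
    · linear_combination u * h.2 - v * h.1 - (b - d) * huv
  · rintro ⟨a, b⟩ hx
    simp only [Finset.mem_filter, mem_normReps] at hx
    obtain ⟨hx, d, hd⟩ := hx
    push_cast at hx
    obtain ⟨c, hc⟩ : (p : ℤ) ∣ a * u + 3 * b * v := by
      apply hp'.dvd_of_dvd_pow (n := 2)
      refine ⟨p * n - 3 * p * d ^ 2, ?_⟩
      linear_combination (u ^ 2 + 3 * v ^ 2) * hx + p * n * huv
        - 3 * (b * u - a * v + p * d) * hd
    refine ⟨(c, d), ?_, ?_⟩
    · rw [mem_normReps]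
      apply mul_left_cancel₀ (pow_ne_zero 2 h0)
      linear_combination (u ^ 2 + 3 * v ^ 2) * hx + p * n * huv
        - 3 * (b * u - a * v + p * d) * hd - (a * u + 3 * b * v + p * c) * hc
    · simp only [Prod.mk.injEq]
      constructor <;> apply mul_left_cancel₀ h0
      · linear_combination a * huv - u * hc + 3 * v * hd
      · linear_combination b * huv - u * hd - v * hc

lemma card_normReps_of_split {p : ℕ} (hp : p.Prime) (hp2 : p ≠ 2) (hp3 : p ≠ 3)
    {u v : ℤ} (huv : u ^ 2 + 3 * v ^ 2 = p) (n : ℕ) :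
    (normReps (p * n)).card + (divReps p (p * n)).card = 2 * (normReps n).card := by
  have hp' : Prime (p : ℤ) := Nat.prime_iff_prime_int.1 hp
  have h1 := card_normReps_filter_dvd hp huv n
  have h2 := card_normReps_filter_dvd hp (u := u) (v := -v) (by rwa [neg_sq]) n
  rw [two_mul]
  have p2 : ¬ (p : ℤ) ∣ 2 := by
    intro h
    exact hp2 ((Nat.prime_dvd_prime_iff_eq hp Nat.prime_two).1 (by exact_mod_cast h))
  have p3 : ¬ (p : ℤ) ∣ 3 := by
    intro h
    exact hp3 ((Nat.prime_dvd_prime_iff_eq hp Nat.prime_three).1 (by exact_mod_cast h))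
  have not_both : ¬ ((p : ℤ) ∣ u ∧ (p : ℤ) ∣ v) := by
    rintro ⟨⟨c, rfl⟩, d, rfl⟩
    apply hp'.not_isUnit
    apply IsUnit.of_mul_eq_one (c ^ 2 + 3 * d ^ 2)
    apply mul_left_cancel₀ hp'.ne_zero
    linear_combination huv
  have pv : ¬ (p : ℤ) ∣ v := by
    intro h
    refine not_both ⟨hp'.dvd_of_dvd_pow (n := 2) ?_, h⟩
    rw [show u ^ 2 = p - 3 * v * v by linear_combination huv]
    exact dvd_sub dvd_rfl (h.mul_left _)
  have pu : ¬ (p : ℤ) ∣ u := by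
    intro h
    refine not_both ⟨h, ?_⟩
    have : (p : ℤ) ∣ 3 * v ^ 2 := by
      rw [show 3 * v ^ 2 = p - u * u by linear_combination huv]
      exact dvd_sub dvd_rfl (h.mul_left _)
    exact hp'.dvd_of_dvd_pow ((hp'.dvd_or_dvd this).resolve_left p3)
  have hunion : (normReps (p * n)).filter (fun x => (p : ℤ) ∣ x.2 * u - x.1 * v) ∪
      (normReps (p * n)).filter (fun x => (p : ℤ) ∣ x.2 * u - x.1 * -v) = normReps (p * n) := by
    ext ⟨a, b⟩
    simp only [Finset.mem_union, Finset.mem_filter, ← and_or_left, and_iff_left_iff_imp,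
      mem_normReps]
    intro h
    apply hp'.dvd_or_dvd
    push_cast at h
    exact ⟨b ^ 2 - v ^ 2 * n, by linear_combination b ^ 2 * huv - v ^ 2 * h⟩
  have hinter : (normReps (p * n)).filter (fun x => (p : ℤ) ∣ x.2 * u - x.1 * v) ∩
      (normReps (p * n)).filter (fun x => (p : ℤ) ∣ x.2 * u - x.1 * -v) = divReps p (p * n) := by
    ext ⟨a, b⟩
    simp only [divReps, Finset.mem_inter, Finset.mem_filter, ← and_and_left]
    refine and_congr_right fun _ => ⟨?_, ?_⟩
    · rintro ⟨h, h'⟩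
      have k1 : (p : ℤ) ∣ 2 * (a * v) := by
        rw [show 2 * (a * v) = (b * u - a * -v) - (b * u - a * v) by ring]
        exact dvd_sub h' h
      have k2 : (p : ℤ) ∣ 2 * (b * u) := by
        rw [show 2 * (b * u) = (b * u - a * -v) + (b * u - a * v) by ring]
        exact dvd_add h' h
      exact ⟨(hp'.dvd_or_dvd ((hp'.dvd_or_dvd k1).resolve_left p2)).resolve_right pv,
        (hp'.dvd_or_dvd ((hp'.dvd_or_dvd k2).resolve_left p2)).resolve_right pu⟩
    · rintro ⟨ha, hb⟩
      exact ⟨dvd_sub (hb.mul_right _) (ha.mul_right _), dvd_sub (hb.mul_right _) (ha.mul_right _)⟩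
  rw [← hunion, ← hinter, Finset.card_union_add_card_inter, h1, h2]

lemma card_normReps_three_mul (n : ℕ) : (normReps (3 * n)).card = (normReps n).card := by
  symm
  refine Finset.card_bij (fun x _ => (3 * x.2, x.1)) ?_ ?_ ?_
  · intro x hx
    rw [mem_normReps] at hx ⊢
    push_cast
    linear_combination 3 * hx
  · rintro ⟨a, b⟩ _ ⟨c, d⟩ _ h
    simp at h ⊢
    exact h.symm
  · rintro ⟨a, b⟩ hx
    rw [mem_normReps] at hx
    push_cast at hx
    obtain ⟨c, rfl⟩ : (3 : ℤ) ∣ a :=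
      Int.prime_three.dvd_of_dvd_pow (n := 2) ⟨n - b ^ 2, by linear_combination hx⟩
    refine ⟨(b, c), ?_, rfl⟩
    rw [mem_normReps]
    apply mul_left_cancel₀ (show (3 : ℤ) ≠ 0 by norm_num)
    linear_combination hx

lemma legendreSym_neg_three {p : ℕ} [Fact p.Prime] (hp2 : p ≠ 2) :
    legendreSym p (-3) = legendreSym 3 p := by
  have h := legendreSym.quadratic_reciprocity' (p := 3) (q := p) (by norm_num) hp2
  have hodd : p % 2 = 1 := (Nat.Prime.mod_two_eq_one_iff_ne_two Fact.out).2 hp2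
  rw [legendreSym.at_neg hp2, ZMod.χ₄_eq_neg_one_pow hodd]
  push_cast at h
  rw [h, ← mul_assoc, ← pow_add]
  norm_num

/-- Thue's lemma. -/
lemma exists_small_linear_relation {p : ℕ} (hp : p.Prime) (s : ZMod p) :
    ∃ a b : ℤ, (a ≠ 0 ∨ b ≠ 0) ∧ a ^ 2 < p ∧ b ^ 2 < p ∧ (a : ZMod p) + s * b = 0 := by
  have := Fact.mk hp
  have bound : ∀ i j : ℕ, i < p.sqrt + 1 → j < p.sqrt + 1 → ((i : ℤ) - j) ^ 2 < p := by
    intro i j hi hj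
    have h1 : p.sqrt * p.sqrt < p := by
      refine lt_of_le_of_ne (Nat.sqrt_le p) fun h => ?_
      exact hp.prime.irreducible.not_isSquare ⟨_, h.symm⟩
    zify at h1 hi hj
    have : |(i : ℤ) - j| ≤ p.sqrt := by rw [abs_le]; constructor <;> linarith
    rw [← sq_abs]
    nlinarith [abs_nonneg ((i : ℤ) - j)]
  obtain ⟨x, hx, y, hy, hne, hxy⟩ := Finset.exists_ne_map_eq_of_card_lt_of_maps_to
    (s := Finset.range (p.sqrt + 1) ×ˢ Finset.range (p.sqrt + 1))
    (t := (Finset.univ : Finset (ZMod p))) (f := fun x => (x.1 : ZMod p) + s * x.2)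
    (by simpa [ZMod.card] using Nat.lt_succ_sqrt p) (fun _ _ => Finset.mem_univ _)
  simp only [Finset.mem_product, Finset.mem_range] at hx hy
  refine ⟨x.1 - y.1, x.2 - y.2, ?_, bound _ _ hx.1 hy.1, bound _ _ hx.2 hy.2, ?_⟩
  · by_contra! h
    exact hne (Prod.ext (by omega) (by omega))
  · push_cast
    linear_combination hxy

/-- A prime `p ≡ 1 mod 3` is represented by `u² + 3v²`. -/
lemma exists_sq_add_three_mul_sq {p : ℕ} (hp : p.Prime) (hp2 : p ≠ 2)
    (h : legendreSym 3 p = 1) : ∃ u v : ℤ, u ^ 2 + 3 * v ^ 2 = p := by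
  have := Fact.mk hp
  have hp0 : (0 : ℤ) < p := by exact_mod_cast hp.pos
  obtain ⟨s, hs⟩ : ∃ s : ZMod p, s ^ 2 = -3 := by
    rw [← legendreSym_neg_three hp2] at h
    have h0 : ((-3 : ℤ) : ZMod p) ≠ 0 := by
      intro h0
      rw [(legendreSym.eq_zero_iff p _).2 h0] at h
      exact zero_ne_one h
    obtain ⟨s, hs⟩ := (legendreSym.eq_one_iff p h0).1 h
    exact ⟨s, by rw [sq, ← hs]; push_cast; rfl⟩
  obtain ⟨a, b, hab, ha, hb, hmod⟩ := exists_small_linear_relation hp s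
  have hdvd : (p : ℤ) ∣ a ^ 2 + 3 * b ^ 2 := by
    rw [← ZMod.intCast_zmod_eq_zero_iff_dvd]
    push_cast
    linear_combination (a - s * b) * hmod + (b : ZMod p) ^ 2 * hs
  obtain ⟨k, hk⟩ := hdvd
  have hpos : 0 < a ^ 2 + 3 * b ^ 2 := by
    rcases hab with h | h <;> positivity
  have hk0 : 0 < k := by
    by_contra! hk0
    nlinarith
  have hk4 : k < 4 := by
    by_contra! hk4
    nlinarith
  interval_cases k
  · exact ⟨a, b, by linear_combination hk⟩
  · exfalso
    obtain ⟨t, ht⟩ : Odd p := hp.odd_of_ne_two hp2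
    subst ht
    push_cast at hk
    rcases Int.even_or_odd' a with ⟨c, rfl | rfl⟩ <;> rcases Int.even_or_odd' b with ⟨d, rfl | rfl⟩ <;>
    ring_nf at hk <;> omega
  · obtain ⟨c, rfl⟩ : (3 : ℤ) ∣ a :=
      Int.prime_three.dvd_of_dvd_pow (n := 2) ⟨p - b ^ 2, by linear_combination hk⟩
    exact ⟨b, c, by linarith⟩

lemma card_normReps_prime_mul {p : ℕ} (hp : p.Prime) (hp2 : p ≠ 2) (n : ℕ) :
    ((normReps (p * n)).card : ℤ) = (1 + legendreSym 3 p) * (normReps n).card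
      - legendreSym 3 p * (divReps p (p * n)).card := by
  have := Fact.mk hp
  by_cases hp3 : p = 3
  · subst hp3
    have : legendreSym 3 (3 : ℕ) = 0 := (legendreSym.eq_zero_iff 3 _).2 rfl
    rw [this, card_normReps_three_mul]
    ring
  have hne : ((p : ℤ) : ZMod 3) ≠ 0 := by
    rw [Int.cast_natCast, Ne, ZMod.natCast_eq_zero_iff]
    exact fun h => hp3 ((Nat.prime_dvd_prime_iff_eq Nat.prime_three hp).1 h).symm
  rcases legendreSym.eq_one_or_neg_one 3 hne with h | h
  · obtain ⟨u, v, huv⟩ := exists_sq_add_three_mul_sq hp hp2 h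
    have := card_normReps_of_split hp hp2 hp3 huv n
    rw [h]
    zify at this
    linear_combination this
  · rw [← legendreSym_neg_three hp2] at h
    have : divReps p (p * n) = normReps (p * n) := by
      refine Finset.filter_true_of_mem fun x hx => ?_
      rw [mem_normReps] at hx
      refine legendreSym.prime_dvd_of_eq_neg_one h ⟨n, ?_⟩
      push_cast at hx
      linear_combination hx
    rw [this, ← legendreSym_neg_three hp2, h]
    ring

lemma card_normReps {n : ℕ} (hn : Odd n) : ((normReps n).card : ℤ) = 2 * lambertCoeff n := by
  induction n using Nat.strong_induction_on with
  | _ n ih =>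
    by_cases h1 : n = 1
    · subst h1
      have : normReps 1 = {(1, 0), (-1, 0)} := by decide
      rw [this]
      simp [lambertCoeff]
    obtain ⟨p, hp, m, rfl⟩ := Nat.exists_prime_and_dvd h1
    obtain ⟨hpo, hmo⟩ := Nat.odd_mul.1 hn
    have hp2 : p ≠ 2 := by rintro rfl; exact absurd hpo (by decide)
    have hm := ih m (by nlinarith [hp.two_le, hmo.pos]) hmo
    rw [card_normReps_prime_mul hp hp2, hm]
    by_cases hpm : p ∣ m
    · obtain ⟨k, rfl⟩ := hpm
      have hko := (Nat.odd_mul.1 hmo).2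
      have hk := ih k (by nlinarith [hp.two_le, hko.pos, Nat.mul_le_mul hp.two_le hp.two_le]) hko
      rw [card_divReps hp, hk, lambertCoeff_prime_mul_prime_mul hp hko.pos.ne']
      ring
    · rw [divReps_eq_empty hp hpm, lambertCoeff_prime_mul_of_not_dvd hp hmo.pos.ne' hpm]
      simp
      ring

/-- The pairs `(i, j)` with `(2i+1)² + 3(2j+1)² = 4n`. -/
def oddReps (n : ℕ) : Finset (ℕ × ℕ) :=
  (Finset.range n ×ˢ Finset.range n).filter fun x =>
    1 + x.1 * (x.1 + 1) + 3 * (x.2 * (x.2 + 1)) = n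

lemma mem_oddReps {n : ℕ} {x : ℕ × ℕ} :
    x ∈ oddReps n ↔ 1 + x.1 * (x.1 + 1) + 3 * (x.2 * (x.2 + 1)) = n := by
  simp only [oddReps, Finset.mem_filter, Finset.mem_product, Finset.mem_range,
    and_iff_right_iff_imp]
  intro h
  constructor <;> nlinarith [Nat.zero_le (x.1 * x.1), Nat.zero_le (x.2 * x.2)]

lemma odd_add_of_mem_normReps {n : ℕ} (hn : Odd n) {x : ℤ × ℤ} (hx : x ∈ normReps n) :
    Odd (x.1 + x.2) := by
  rw [mem_normReps] at hx
  have h : Odd (x.1 ^ 2 + 3 * x.2 ^ 2) := by rw [hx]; exact_mod_cast hn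
  simp only [Int.odd_add, Int.even_mul, Int.odd_pow, Int.even_pow] at h ⊢
  simpa [show ¬ Even (3 : ℤ) by decide] using h

lemma card_normReps_pos {n : ℕ} (hn : Odd n) :
    ((normReps n).filter fun x => 0 < x.1 + 3 * x.2).card = (oddReps n).card := by
  refine Finset.card_bij
    (fun x _ => ((x.1 + 3 * x.2).natAbs / 2, (x.1 - x.2).natAbs / 2)) ?_ ?_ ?_
  · rintro ⟨a, b⟩ hx
    simp only [Finset.mem_filter] at hx
    obtain ⟨t, ht⟩ := odd_add_of_mem_normReps hn hx.1
    simp only [mem_normReps] at hx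
    dsimp only at ht
    rw [mem_oddReps]
    have h1 : 2 * (((a + 3 * b).natAbs / 2 : ℕ) : ℤ) + 1 = |a + 3 * b| := by
      rw [Int.abs_eq_natAbs]
      omega
    have h2 : 2 * (((a - b).natAbs / 2 : ℕ) : ℤ) + 1 = |a - b| := by
      rw [Int.abs_eq_natAbs]
      omega
    have h3 := congrArg (· ^ 2) h1
    have h4 := congrArg (· ^ 2) h2
    simp only [sq_abs] at h3 h4
    zify
    push_cast at h3 h4 ⊢
    linarith [hx.1]
  · rintro ⟨a, b⟩ hx ⟨c, d⟩ hy h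
    simp only [Finset.mem_filter] at hx hy
    obtain ⟨t, ht⟩ := odd_add_of_mem_normReps hn hx.1
    obtain ⟨t', ht'⟩ := odd_add_of_mem_normReps hn hy.1
    simp only [Prod.mk.injEq] at h ht ht' hx hy ⊢
    omega
  · rintro ⟨i, j⟩ hx
    rw [mem_oddReps] at hx
    zify at hx
    obtain ⟨b, hb | hb⟩ : ∃ b : ℤ, (i : ℤ) - j = 2 * b ∨ (i : ℤ) + j + 1 = 2 * b := by
      rcases Int.even_or_odd' ((i : ℤ) - j) with ⟨b, h | h⟩
      · exact ⟨b, .inl h⟩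
      · exact ⟨b + j + 1, .inr (by linarith)⟩
    · refine ⟨(b + (2 * j + 1), b), ?_, ?_⟩
      · rw [Finset.mem_filter, mem_normReps]
        refine ⟨?_, by dsimp only; omega⟩
        have hj : (j : ℤ) = i - 2 * b := by linarith
        rw [hj] at hx ⊢
        linear_combination hx
      · ext <;> dsimp only <;> omega
    · refine ⟨(b - (2 * j + 1), b), ?_, ?_⟩
      · rw [Finset.mem_filter, mem_normReps]
        refine ⟨?_, by dsimp only; omega⟩
        have hi : (i : ℤ) = 2 * b - 1 - j := by linarith
        rw [hi] at hx
        linear_combination hx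
      · ext <;> dsimp only <;> omega

lemma card_normReps_eq_two_mul {n : ℕ} (hn : Odd n) :
    (normReps n).card = 2 * (oddReps n).card := by
  rw [← Finset.card_filter_add_card_filter_not (s := normReps n) (fun x => 0 < x.1 + 3 * x.2),
    card_normReps_pos hn, two_mul]
  congr 1
  rw [← card_normReps_pos hn]
  refine Finset.card_bij (fun x _ => -x) ?_ ?_ ?_
  · rintro ⟨a, b⟩ hx
    rw [Finset.mem_filter] at hx ⊢
    obtain ⟨t, ht⟩ := odd_add_of_mem_normReps hn hx.1
    simp only [mem_normReps, Prod.neg_mk, neg_sq] at hx ht ⊢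
    exact ⟨hx.1, by omega⟩
  · intro x _ y _ h
    exact neg_injective h
  · rintro ⟨a, b⟩ hx
    refine ⟨-(a, b), ?_, neg_neg _⟩
    simp only [Finset.mem_filter, mem_normReps, Prod.neg_mk, neg_sq] at hx ⊢
    exact ⟨hx.1, by omega⟩

/-- The coefficient of `q ^ n` in the Lambert series with `q` replaced by `q ^ 4`. -/
def lambertCoeffFour (n : ℕ) : ℤ := if 4 ∣ n then lambertCoeff (n / 4) else 0

lemma card_oddReps (n : ℕ) : ((oddReps n).card : ℤ) = lambertCoeff n - lambertCoeffFour n := by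
  rcases Nat.even_or_odd' n with ⟨m, rfl | rfl⟩
  · have h0 : oddReps (2 * m) = ∅ := by
      refine Finset.eq_empty_of_forall_notMem fun x hx => ?_
      rw [mem_oddReps] at hx
      obtain ⟨s, hs⟩ := Nat.even_mul_succ_self x.1
      obtain ⟨t, ht⟩ := Nat.even_mul_succ_self x.2
      omega
    have h2 : legendreSym 3 (2 : ℕ) = -1 := by
      rw [legendreSym.eq_neg_one_iff]
      decide
    rw [h0, lambertCoeffFour]
    rcases Nat.eq_zero_or_pos m with rfl | hm
    · simp [lambertCoeff]
    by_cases h4 : 2 ∣ m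
    · obtain ⟨k, rfl⟩ := h4
      rw [if_pos ⟨k, by ring⟩, lambertCoeff_prime_mul_prime_mul Nat.prime_two (by omega), h2,
        show 2 * (2 * k) / 4 = k by omega]
      simp
    · rw [if_neg (by omega), lambertCoeff_prime_mul_of_not_dvd Nat.prime_two hm.ne' h4, h2]
      simp
  · have ho : Odd (2 * m + 1) := ⟨m, rfl⟩
    have h1 := card_normReps ho
    rw [card_normReps_eq_two_mul ho] at h1
    rw [lambertCoeffFour, if_neg (by omega)]
    push_cast at h1
    linarith

lemma HasSum.collect_powers {ι : Type*} {g : ι → ℕ} {w : ι → ℂ} {q a : ℂ} {F : ℕ → Finset ι}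
    (hF : ∀ n x, x ∈ F n ↔ g x = n) (h : HasSum (fun x => w x * q ^ g x) a) :
    HasSum (fun n => (∑ x ∈ F n, w x) * q ^ n) a := by
  suffices hfib : ∀ n, ∑' x : g ⁻¹' {n}, w x * q ^ g x = (∑ x ∈ F n, w x) * q ^ n by
    simpa only [hfib] using h.tsum_fiberwise g
  intro n
  have hs : g ⁻¹' {n} = (F n : Set ι) := by
    ext x
    simp [hF]
  rw [hs, Finset.tsum_subtype' (F n) (fun x => w x * q ^ g x), Finset.sum_mul]
  refine Finset.sum_congr rfl fun x hx => ?_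
  rw [(hF n x).1 hx]

/-- The pairs `(j, k)` with `(j + 1) * (k + 1) = n`. -/
def succFactorPairs (n : ℕ) : Finset (ℕ × ℕ) :=
  (Finset.range n ×ˢ Finset.range n).filter fun x => (x.1 + 1) * (x.2 + 1) = n

lemma mem_succFactorPairs (n : ℕ) (x : ℕ × ℕ) :
    x ∈ succFactorPairs n ↔ (x.1 + 1) * (x.2 + 1) = n := by
  simp only [succFactorPairs, Finset.mem_filter, Finset.mem_product, Finset.mem_range,
    and_iff_right_iff_imp]
  intro h
  constructor <;> nlinarith [Nat.zero_le (x.1 * x.2)]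

lemma sum_succFactorPairs (n : ℕ) :
    ∑ x ∈ succFactorPairs n, legendreSym 3 ((x.1 : ℤ) + 1) = lambertCoeff n := by
  refine Finset.sum_bij (fun x _ => x.1 + 1) ?_ ?_ ?_ ?_
  · intro x hx
    rw [mem_succFactorPairs] at hx
    rw [Nat.mem_divisors, ← hx]
    exact ⟨dvd_mul_right _ _, by positivity⟩
  · rintro ⟨a, b⟩ hx ⟨c, d⟩ hy h
    rw [mem_succFactorPairs] at hx hy
    obtain rfl : a = c := by simpa using h
    simp only [Prod.mk.injEq, true_and]
    simpa using hx.trans hy.symm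
  · intro d hd
    obtain ⟨⟨e, rfl⟩, h0⟩ := Nat.mem_divisors.1 hd
    obtain ⟨hd0, he0⟩ := mul_ne_zero_iff.1 h0
    refine ⟨(d - 1, e - 1), ?_, ?_⟩
    · rw [mem_succFactorPairs]
      simp only [Nat.sub_add_cancel (Nat.pos_of_ne_zero hd0),
        Nat.sub_add_cancel (Nat.pos_of_ne_zero he0)]
    · exact Nat.sub_add_cancel (Nat.pos_of_ne_zero hd0)
  · intro x _
    push_cast
    rfl

lemma norm_legendreSym_le_one (p : ℕ) [Fact p.Prime] (a : ℤ) : ‖(legendreSym p a : ℂ)‖ ≤ 1 := by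
  by_cases h : (a : ZMod p) = 0
  · rw [(legendreSym.eq_zero_iff p a).2 h]
    simp
  · rcases legendreSym.eq_one_or_neg_one p h with h | h <;> rw [h] <;> simp

lemma exists_hasSum_lambert {q : ℂ} (hq : ‖q‖ < 1) :
    ∃ S : ℂ, HasSum (fun n => (lambertCoeff n : ℂ) * q ^ n) S ∧
      HasSum (fun j : ℕ => (legendreSym 3 ((j : ℤ) + 1) : ℂ) *
        (q ^ (j + 1) / (1 - q ^ (j + 1)))) S := by
  have hs : Summable fun x : ℕ × ℕ =>
      (legendreSym 3 ((x.1 : ℤ) + 1) : ℂ) * q ^ ((x.1 + 1) * (x.2 + 1)) := by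
    have hg := summable_geometric_of_lt_one (norm_nonneg q) hq
    refine Summable.of_norm_bounded (hg.mul_of_nonneg hg (fun _ => by positivity)
      (fun _ => by positivity)) fun x => ?_
    rw [norm_mul, norm_pow, ← pow_add]
    calc _ ≤ 1 * ‖q‖ ^ ((x.1 + 1) * (x.2 + 1)) := by
          gcongr
          exact norm_legendreSym_le_one 3 _
      _ ≤ ‖q‖ ^ (x.1 + x.2) := by
          rw [one_mul]
          exact pow_le_pow_of_le_one (norm_nonneg q) hq.le (by nlinarith)
  refine ⟨_, ?_, hs.hasSum.prod_fiberwise fun j => ?_⟩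
  · convert hs.hasSum.collect_powers mem_succFactorPairs using 3 with n
    rw [← sum_succFactorPairs]
    push_cast
    rfl
  · have hj : ‖q ^ (j + 1)‖ < 1 := by
      rw [norm_pow]
      exact pow_lt_one₀ (norm_nonneg q) hq (Nat.succ_ne_zero j)
    have := ((hasSum_geometric_of_norm_lt_one hj).mul_left (q ^ (j + 1))).mul_left
      (legendreSym 3 ((j : ℤ) + 1) : ℂ)
    simpa only [pow_mul, pow_succ' (q ^ (j + 1)), div_eq_mul_inv] using this

lemma summable_norm_pow_triangular {q : ℂ} (hq : ‖q‖ < 1) :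
    Summable fun n : ℕ => ‖q ^ (n * (n + 1) / 2)‖ := by
  refine Summable.of_nonneg_of_le (fun _ => norm_nonneg _) (fun n => ?_)
    (summable_geometric_of_lt_one (norm_nonneg q) hq)
  rw [norm_pow]
  refine pow_le_pow_of_le_one (norm_nonneg q) hq.le ?_
  rw [Nat.le_div_iff_mul_le two_pos]
  rcases Nat.eq_zero_or_pos n with rfl | hn
  · simp
  · exact Nat.mul_le_mul_left n (by omega)

lemma hasSum_card_oddReps {q : ℂ} (hq : ‖q‖ < 1) :
    HasSum (fun n => ((oddReps n).card : ℂ) * q ^ n)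
      (q * (∑' n : ℕ, (q ^ 2) ^ (n * (n + 1) / 2)) *
        (∑' n : ℕ, (q ^ 6) ^ (n * (n + 1) / 2))) := by
  have hpow : ∀ k ≠ 0, ‖q ^ k‖ < 1 := fun k hk => by
    rw [norm_pow]
    exact pow_lt_one₀ (norm_nonneg q) hq hk
  have h2 := summable_norm_pow_triangular (hpow 2 (by norm_num))
  have h6 := summable_norm_pow_triangular (hpow 6 (by norm_num))
  have h := ((summable_mul_of_summable_norm h2 h6).hasSum).mul_left q
  rw [← tsum_mul_tsum_of_summable_norm h2 h6, ← mul_assoc] at h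
  have hterm : ∀ x : ℕ × ℕ,
      q * ((q ^ 2) ^ (x.1 * (x.1 + 1) / 2) * (q ^ 6) ^ (x.2 * (x.2 + 1) / 2)) =
      1 * q ^ (1 + x.1 * (x.1 + 1) + 3 * (x.2 * (x.2 + 1))) := fun x => by
    obtain ⟨s, hs⟩ := (Nat.even_mul_succ_self x.1).two_dvd
    obtain ⟨t, ht⟩ := (Nat.even_mul_succ_self x.2).two_dvd
    rw [hs, ht, Nat.mul_div_cancel_left _ two_pos, Nat.mul_div_cancel_left _ two_pos]
    ring
  simp only [hterm] at h
  simpa using h.collect_powers (fun n x => mem_oddReps)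

lemma hasSum_lambertCoeffFour {q S : ℂ}
    (h : HasSum (fun n => (lambertCoeff n : ℂ) * (q ^ 4) ^ n) S) :
    HasSum (fun n => (lambertCoeffFour n : ℂ) * q ^ n) S := by
  have hinj : Function.Injective fun n : ℕ => 4 * n := fun a b h => by simpa using h
  rw [← hinj.hasSum_iff]
  · convert h using 2 with n
    simp [lambertCoeffFour, pow_mul]
  · intro n hn
    rw [lambertCoeffFour, if_neg]
    · simp
    · rintro ⟨m, rfl⟩
      exact hn ⟨m, rfl⟩

theorem statement1 (q : ℂ) (hq : ‖q‖ < 1) :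
    q * (∑' n : ℕ, (q ^ 2) ^ (n * (n + 1) / 2)) * (∑' n : ℕ, (q ^ 6) ^ (n * (n + 1) / 2)) =
      ∑' j : ℕ, (legendreSym 3 ((j : ℤ) + 1) : ℂ) * (q ^ (1 * (j + 1)) / (1 - q ^ (1 * (j + 1))) - q ^ (4 * (j + 1)) / (1 - q ^ (4 * (j + 1)))) := by
  have hq4 : ‖q ^ 4‖ < 1 := by
    rw [norm_pow]
    exact pow_lt_one₀ (norm_nonneg q) hq (by norm_num)
  obtain ⟨S, hS, hSj⟩ := exists_hasSum_lambert hq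
  obtain ⟨T, hT, hTj⟩ := exists_hasSum_lambert hq4
  have hR := hSj.sub hTj
  simp only [← mul_sub, ← pow_mul] at hR
  simp only [one_mul]
  rw [hR.tsum_eq]
  refine (hasSum_card_oddReps hq).unique ?_
  simpa only [← sub_mul, ← Int.cast_sub, ← card_oddReps, Int.cast_natCast] using
    hS.sub (hasSum_lambertCoeffFour hT)
end
end
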